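/- arXiv:2408.08223 — 7 statements merged into one kernel-verified Lean document; each statement's English description precedes it below -/
import Mathlib

section
/- Let G be an abelian group, let k ≥ 1 be an integer, and let y ∈ G^m be a word that factors as y = u v w with |u| = i and |v| = k. Writing Δ_k(y) = (d_1, ..., d_m), the k-step derivative of the tandem-duplicated word satisfies Δ_k(u v v w) = (d_1, ..., d_{i+k}, 0, 0, ..., 0, d_{i+k+1}, ..., d_m) with a block of k zeros; that is, Δ_k(T_{i,k}(y)) is obtained from Δ_k(y) by inserting the block 0^k immediately after position i+k. -/
/-- The composition of a word over `Fin q`, as an element of `ℤ^q`: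
it counts, for each letter `a`, the number of occurrences of `a`. -/
def comp {q : ℕ} (w : List (Fin q)) : Fin q → ℤ := fun a => (w.count a : ℤ)

/-- The `ℓ`-read vector of a word over `Fin q`: a word of length `n + ℓ - 1`
over `ℤ^q` whose `p`-th entry is the composition of the window of the last `ℓ`
symbols ending at position `p` (symbols outside the word are omitted). -/
def readVec {q : ℕ} (ℓ : ℕ) (x : List (Fin q)) : List (Fin q → ℤ) :=
  (List.range (x.length + ℓ - 1)).map fun p => comp ((x.take (p + 1)).drop (p + 1 - ℓ))

/-- The `k`-step derivative of a word over an abelian group, with the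
convention that entries at nonpositive positions are `0`. -/
def kderiv {G : Type*} [AddCommGroup G] (k : ℕ) (y : List G) : List G :=
  (List.range y.length).map fun i => y.getD i 0 - if k ≤ i then y.getD (i - k) 0 else 0

/-- The lengths `(m_0, m_1, ..., m_s)` of the maximal (possibly empty) runs of
zeros in `y = 0^{m_0} y_1 0^{m_1} ⋯ y_s 0^{m_s}` with `y_1, ..., y_s ≠ 0`. -/
def zeroRuns {G : Type*} [Zero G] [DecidableEq G] (y : List G) : List ℕ :=
  (y.splitOnP fun a => decide (a ≠ 0)).map List.length

/-- `σ_k(y) = (⌊m_0/k⌋, ⌊m_1/k⌋, ..., ⌊m_s/k⌋)`. -/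
def sigmak {G : Type*} [Zero G] [DecidableEq G] (k : ℕ) (y : List G) : List ℕ :=
  (zeroRuns y).map fun m => m / k

/-- Interleave zero runs of the given lengths with the given (nonzero) letters:
`assemble (m_0 :: ... :: m_s) (y_1 :: ... :: y_s) = 0^{m_0} y_1 0^{m_1} ⋯ y_s 0^{m_s}`. -/
def assemble {G : Type*} [Zero G] : List ℕ → List G → List G
  | [], _ => []
  | m :: _, [] => List.replicate m (0 : G)
  | m :: ms, a :: as => List.replicate m (0 : G) ++ a :: assemble ms as

/-- `μ_k(y) = 0^{m_0 % k} y_1 0^{m_1 % k} ⋯ y_s 0^{m_s % k}`. -/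
def muk {G : Type*} [Zero G] [DecidableEq G] (k : ℕ) (y : List G) : List G :=
  assemble ((zeroRuns y).map fun m => m % k) (y.filter fun a => decide (a ≠ 0))

/-- The nucleus `N_{k,ℓ}(x) = μ_k(Δ_k(R_ℓ(x)))` of a word over `Fin q`. -/
def nucleus {q : ℕ} (k ℓ : ℕ) (x : List (Fin q)) : List (Fin q → ℤ) :=
  muk k (kderiv k (readVec ℓ x))

/-- A single tandem duplication of length `k`: `u v w ↦ u v v w` with `|v| = k`. -/
def TD {α : Type*} (k : ℕ) (y z : List α) : Prop :=
  ∃ u v w : List α, v.length = k ∧ y = u ++ (v ++ w) ∧ z = u ++ (v ++ (v ++ w))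

/-- `TDt k t y z` holds iff `z` arises from `y` by a sequence of exactly `t`
tandem duplications of length `k`, i.e. `y ⟹_k^t z`. -/
def TDt {α : Type*} (k : ℕ) : ℕ → List α → List α → Prop
  | 0 => fun y z => y = z
  | t + 1 => fun y z => ∃ w, TDt k t y w ∧ TD k w z

/-- The ball `B_{k,t}(y)`: all words obtained from `y` by at most `t` tandem
duplications of length `k`. -/
def Ball {α : Type*} (k t : ℕ) (y : List α) : Set (List α) :=
  {z | ∃ j ≤ t, TDt k j y z}

/-- `x` is `(k,ℓ)`-fine: it contains no `k`-periodic factor of length `2k+ℓ-1`. -/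
def Fine {q : ℕ} (k ℓ : ℕ) (x : List (Fin q)) : Prop :=
  ∀ i : ℕ, 1 ≤ i → i + 2 * k + ℓ - 2 ≤ x.length →
    (x.drop (i - 1)).take (k + ℓ - 1) ≠ (x.drop (i - 1 + k)).take (k + ℓ - 1)

/-- `y` contains the factor `0^k` (a run of `k` consecutive zeros). -/
def HasZeroBlock {G : Type*} [Zero G] (k : ℕ) (y : List G) : Prop :=
  ∃ j, j + k ≤ y.length ∧ (y.drop j).take k = List.replicate k (0 : G)

/-- `λ_{m,q}`: the largest real root of `x^{m+2} - q·x^{m+1} + q - 1`. -/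
noncomputable def lambdaRoot (m q : ℕ) : ℝ :=
  sSup {x : ℝ | x ^ (m + 2) - (q : ℝ) * x ^ (m + 1) + (q : ℝ) - 1 = 0}

/-- The dot product `a ⊙ b = Σ_{i=1}^{min(|a|,|b|)} a_i · b_i`. -/
def dot {G : Type*} [AddCommMonoid G] (a : List ℕ) (b : List G) : G :=
  (List.zipWith (fun m g => m • g) a b).sum

theorem length_kderiv {G : Type*} [AddCommGroup G] (k : ℕ) (y : List G) :
    (kderiv k y).length = y.length := by
  simp [kderiv]

theorem getElem_kderiv {G : Type*} [AddCommGroup G] (k : ℕ) (y : List G) (n : ℕ)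
    (h : n < (kderiv k y).length) :
    (kderiv k y)[n] = y.getD n 0 - if k ≤ n then y.getD (n - k) 0 else 0 := by
  simp [kderiv]

theorem getD_duplicate_of_lt {α : Type*} (u v w : List α) (d : α) {n : ℕ}
    (hn : n < u.length + v.length) :
    (u ++ (v ++ (v ++ w))).getD n d = (u ++ (v ++ w)).getD n d := by
  rw [← List.append_assoc u, ← List.append_assoc u, List.getD_append (u ++ v) _ _ _ (by simpa),
    List.getD_append (u ++ v) _ _ _ (by simpa)]

theorem getD_duplicate_of_le {α : Type*} (u v w : List α) (d : α) {n : ℕ}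
    (hn : u.length + v.length ≤ n) :
    (u ++ (v ++ (v ++ w))).getD n d = (u ++ (v ++ w)).getD (n - v.length) d := by
  rw [← List.append_assoc u, List.getD_append_right _ _ _ _ (by simpa),
    List.getD_append_right u _ _ _ (by omega), List.length_append]
  congr 1
  omega

/-- the `k`-step derivative of a tandem-duplicated word
`T_{i,k}(y) = u v v w` (with `|u| = i`, `|v| = k`) is obtained from the
`k`-step derivative of `y = u v w` by inserting the block `0^k` immediately
after position `i + k`. -/
theorem stmt_0 {G : Type*} [AddCommGroup G] (k : ℕ) (hk : 1 ≤ k)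
    (u v w : List G) (hv : v.length = k) :
    kderiv k (u ++ (v ++ (v ++ w))) =
      (kderiv k (u ++ (v ++ w))).take (u.length + k) ++
        (List.replicate k (0 : G) ++ (kderiv k (u ++ (v ++ w))).drop (u.length + k)) := by
  subst hv
  refine List.ext_getElem ?_ fun n h₁ h₂ => ?_
  · simp only [length_kderiv, List.length_append, List.length_take, List.length_drop,
      List.length_replicate]
    omega
  · simp only [length_kderiv, List.length_append] at h₁
    simp only [List.getElem_append, List.getElem_take, List.getElem_drop, getElem_kderiv,
      List.getElem_replicate, List.length_take, length_kderiv, List.length_append,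
      List.length_replicate]
    have hmin : min (u.length + v.length) (u.length + (v.length + w.length)) =
        u.length + v.length := by omega
    simp only [hmin]
    split_ifs with h_ge h_lt h_block h_ge' h_lt'
    all_goals try omega
    · rw [getD_duplicate_of_lt _ _ _ _ h_lt, getD_duplicate_of_lt _ _ _ _ (by omega)]
    · rw [getD_duplicate_of_le _ _ _ _ (by omega), getD_duplicate_of_lt _ _ _ _ (by omega),
        sub_self]
    · rw [getD_duplicate_of_le _ _ _ _ (by omega), getD_duplicate_of_le _ _ _ _ (by omega)]
      congr 2 <;> omega
    · rw [getD_duplicate_of_lt _ _ _ _ h_lt']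
end

section
/- Let G be an abelian group and let k ≥ 1 and t ≥ 0 be integers. Let z be a word over G and suppose z ⟹_k^t z'. Then μ_k(Δ_k(z')) = μ_k(Δ_k(z)); in particular σ_k(Δ_k(z)) and σ_k(Δ_k(z')) are integer vectors of the same length, every entry of the difference σ_k(Δ_k(z')) − σ_k(Δ_k(z)) is nonnegative, and the entries of σ_k(Δ_k(z')) − σ_k(Δ_k(z)) sum to t. -/
theorem zeroRuns_cons {G : Type*} [Zero G] [DecidableEq G] (x : G) (y : List G) :
    zeroRuns (x :: y) = if x = 0 then (zeroRuns y).modifyHead (· + 1) else 0 :: zeroRuns y := by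
  unfold zeroRuns
  rw [List.splitOnP_cons_eq_if_modifyHead]
  by_cases hx : x = 0
  · cases List.splitOnP (fun a : G => decide (a ≠ 0)) y <;> simp [hx]
  · simp [hx]

theorem zeroRuns_ne_nil {G : Type*} [Zero G] [DecidableEq G] (y : List G) : zeroRuns y ≠ [] := by
  simp [zeroRuns, List.splitOnP_ne_nil]

theorem zeroRuns_replicate_append {G : Type*} [Zero G] [DecidableEq G] (k : ℕ) (y : List G) :
    zeroRuns (List.replicate k 0 ++ y) = (zeroRuns y).modifyHead (· + k) := by
  induction k with
  | zero => cases h : zeroRuns y <;> simp [h]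
  | succ k ih =>
    rw [List.replicate_succ, List.cons_append, zeroRuns_cons, if_pos rfl, ih]
    cases zeroRuns y <;> simp [add_assoc]

/-- Inserting `k` consecutive zeros lengthens exactly one zero run, by `k`. -/
theorem exists_zeroRuns_insert {G : Type*} [Zero G] [DecidableEq G] (k : ℕ) (a b : List G) :
    ∃ (L : List ℕ) (m : ℕ) (R : List ℕ), zeroRuns (a ++ b) = L ++ m :: R ∧
      zeroRuns (a ++ (List.replicate k 0 ++ b)) = L ++ (m + k) :: R := by
  induction a with
  | nil =>
    obtain ⟨m, R, h⟩ := List.exists_cons_of_ne_nil (zeroRuns_ne_nil b)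
    exact ⟨[], m, R, by simp [h], by simp [zeroRuns_replicate_append, h]⟩
  | cons x a ih =>
    obtain ⟨L, m, R, h₁, h₂⟩ := ih
    by_cases hx : x = 0
    · cases L with
      | nil =>
        exact ⟨[], m + 1, R, by simp [zeroRuns_cons, hx, h₁],
          by simp [zeroRuns_cons, hx, h₂, add_right_comm]⟩
      | cons l L =>
        exact ⟨(l + 1) :: L, m, R, by simp [zeroRuns_cons, hx, h₁],
          by simp [zeroRuns_cons, hx, h₂]⟩
    · exact ⟨0 :: L, m, R, by simp [zeroRuns_cons, hx, h₁], by simp [zeroRuns_cons, hx, h₂]⟩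

/-- A tandem duplication of length `k` inserts `k` consecutive zeros into the `k`-step
derivative. -/
theorem TD.exists_kderiv {G : Type*} [AddCommGroup G] {k : ℕ} {y z : List G} (h : TD k y z) :
    ∃ a b : List G, kderiv k y = a ++ b ∧ kderiv k z = a ++ (List.replicate k 0 ++ b) := by
  obtain ⟨u, v, w, hv, rfl, rfl⟩ := h
  refine ⟨_, _, (List.take_append_drop (u.length + k) _).symm, ?_⟩
  apply List.ext_getElem
  · simp [kderiv]
    omega
  · intro i h₁ h₂
    simp only [kderiv, List.length_map, List.length_range] at h₁
    simp only [kderiv, List.getElem_append, List.getElem_map, List.getElem_range,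
      List.getElem_take, List.getElem_drop, List.getElem_replicate, List.length_take,
      List.length_map, List.length_range, List.length_replicate]
    simp only [List.getD_eq_getElem?_getD]
    grind

theorem TD.muk_sigmak {G : Type*} [AddCommGroup G] [DecidableEq G] {k : ℕ} (hk : 1 ≤ k)
    {y z : List G} (h : TD k y z) :
    muk k (kderiv k z) = muk k (kderiv k y) ∧
      (sigmak k (kderiv k z)).length = (sigmak k (kderiv k y)).length ∧
      (∀ i : ℕ, (sigmak k (kderiv k y)).getD i 0 ≤ (sigmak k (kderiv k z)).getD i 0) ∧
      (sigmak k (kderiv k z)).sum = (sigmak k (kderiv k y)).sum + 1 := by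
  obtain ⟨a, b, hy, hz⟩ := h.exists_kderiv
  obtain ⟨L, m, R, h₁, h₂⟩ := exists_zeroRuns_insert k a b
  rw [← hy] at h₁
  rw [← hz] at h₂
  have hd : (m + k) / k = m / k + 1 := Nat.add_div_right m hk
  refine ⟨?_, ?_, fun i => ?_, ?_⟩
  · unfold muk
    rw [h₁, h₂, hy, hz]
    simp
  · simp [sigmak, h₁, h₂]
  · simp only [sigmak, h₁, h₂, List.map_append, List.map_cons, hd, List.getD_eq_getElem?_getD,
      List.getElem?_append, List.getElem?_cons]
    split_ifs <;> simp
  · simp only [sigmak, h₁, h₂, List.map_append, List.map_cons, hd, List.sum_append, List.sum_cons]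
    omega

/-- if `z ⟹_k^t z'`, then `μ_k(Δ_k(z')) = μ_k(Δ_k(z))`; in
particular `σ_k(Δ_k(z))` and `σ_k(Δ_k(z'))` have the same length, the
difference `σ_k(Δ_k(z')) − σ_k(Δ_k(z))` has nonnegative entries, and its
entries sum to `t`. -/
theorem stmt_1 {G : Type*} [AddCommGroup G] [DecidableEq G] (k t : ℕ) (hk : 1 ≤ k)
    (z z' : List G) (h : TDt k t z z') :
    muk k (kderiv k z') = muk k (kderiv k z) ∧
      (sigmak k (kderiv k z')).length = (sigmak k (kderiv k z)).length ∧
      (∀ i : ℕ, (sigmak k (kderiv k z)).getD i 0 ≤ (sigmak k (kderiv k z')).getD i 0) ∧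
      (sigmak k (kderiv k z')).sum = (sigmak k (kderiv k z)).sum + t := by
  induction t generalizing z' with
  | zero =>
    obtain rfl : z = z' := h
    simp
  | succ t ih =>
    obtain ⟨w, hw, hd⟩ := h
    obtain ⟨h₁, h₂, h₃, h₄⟩ := ih w hw
    obtain ⟨g₁, g₂, g₃, g₄⟩ := hd.muk_sigmak hk
    exact ⟨g₁.trans h₁, g₂.trans h₂, fun i => (h₃ i).trans (g₃ i), by omega⟩
end

section
/- Let q ≥ 2 and k, ℓ ≥ 2 be integers with ℓ | k. Let x ∈ Z_q^n and let i be an integer with 1 ≤ i ≤ n−2k−ℓ+2. If Δ_k(R_ℓ(x)) has entry 0 in every position p with i+k+ℓ−1 ≤ p ≤ i+2k+ℓ−2 (i.e., it contains the factor 0^k starting at position i+k+ℓ−1), then the factor x[i, i+2k+ℓ−2] = (x_i, ..., x_{i+2k+ℓ−2}) is k-periodic. -/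
theorem comp_drop_take {q : ℕ} (x : List (Fin q)) (a : Fin q) (s : ℕ) :
    ∀ m, s + m ≤ x.length → comp ((x.take (s + m)).drop s) =
      ∑ j ∈ Finset.range m, Pi.single (x.getD (s + j) a) (1 : ℤ) := by
  intro m
  induction m with
  | zero => intro _; funext c; simp [comp]
  | succ m ih =>
    intro h
    have hlt : s + m < x.length := by omega
    rw [Finset.sum_range_succ, ← ih (by omega), ← Nat.add_assoc,
      List.take_succ_eq_append_getElem hlt,
      List.drop_append_of_le_length (by simp; omega)]
    funext c
    simp only [comp, List.count_append, Pi.add_apply, List.getD_eq_getElem _ _ hlt]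
    by_cases hc : x[s + m] = c
    · subst hc; simp
    · simp [hc, Ne.symm hc]

/-- A difference of two distinct unit vectors determines both of them. -/
theorem single_sub_single_injective {α : Type*} [DecidableEq α] {a b c d : α} (hab : a ≠ b)
    (h : (Pi.single a 1 - Pi.single b 1 : α → ℤ) = Pi.single c 1 - Pi.single d 1) :
    a = c ∧ b = d := by
  have ha := congrFun h a
  have hb := congrFun h b
  simp only [Pi.sub_apply, Pi.single_apply] at ha hb
  grind

/-- If all windows of length `ℓ` starting in `[0, k)` have the same composition as their
shifts by `k`, where `ℓ ∣ k`, then the sequence is `k`-periodic on the covered positions. -/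
theorem periodic_of_window_sums_eq {α : Type*} [DecidableEq α] {k ℓ : ℕ} (hk : 0 < k)
    (hdvd : ℓ ∣ k) (f : ℕ → α)
    (h : ∀ s < k, ∑ j ∈ Finset.range ℓ,
      (Pi.single (f (s + j + k)) 1 - Pi.single (f (s + j)) 1 : α → ℤ) = 0) :
    ∀ j, j + 1 < k + ℓ → f (j + k) = f j := by
  have hl : 0 < ℓ := Nat.pos_of_dvd_of_pos hdvd hk
  set d : ℕ → α → ℤ := fun j => Pi.single (f (j + k)) 1 - Pi.single (f j) 1 with hd
  have d_eq_zero {j} : d j = 0 ↔ f (j + k) = f j := by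
    rw [hd, sub_eq_zero]
    constructor
    · intro e
      have := congrFun e (f j)
      simp only [Pi.single_apply] at this
      grind
    · intro e
      rw [e]
  have d_add {s} (hs : s + 1 < k) : d (s + ℓ) = d s := by
    have h1 : ∑ j ∈ Finset.range ℓ, d (s + j) = 0 := h s (by omega)
    have h2 : ∑ j ∈ Finset.range ℓ, d (s + 1 + j) = 0 := h (s + 1) hs
    have h3 := Finset.sum_range_succ (fun j => d (s + j)) ℓ
    rw [Finset.sum_range_succ', h1] at h3
    simp only [Nat.add_zero, zero_add] at h3
    rw [← h3, add_eq_right, ← h2]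
    exact Finset.sum_congr rfl fun j _ => by rw [Nat.add_right_comm, Nat.add_assoc]
  have initial {j} (hj : j + 1 < ℓ) : f (j + k) = f j := by
    by_contra hne
    have step : ∀ t, t * ℓ ≤ k → d (j + t * ℓ) = d j := by
      intro t
      induction t with
      | zero => simp
      | succ t ih =>
        intro ht
        rw [Nat.succ_mul] at ht ⊢
        rw [← Nat.add_assoc, d_add (by omega), ih (by omega)]
    obtain ⟨m, rfl⟩ := hdvd
    have hd' := step m (by rw [Nat.mul_comm])
    rw [Nat.mul_comm m] at hd'
    exact hne (single_sub_single_injective hne hd'.symm).2.symm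
  intro j
  induction j using Nat.strong_induction_on with
  | _ j ih =>
    intro hj
    rcases lt_trichotomy (j + 1) ℓ with hlt | heq | hgt
    · exact initial hlt
    · have h0 : ∑ j ∈ Finset.range ℓ, d (0 + j) = 0 := h 0 hk
      subst heq
      rw [Finset.sum_range_succ, Finset.sum_eq_zero, zero_add, Nat.zero_add] at h0
      · exact d_eq_zero.1 h0
      · intro i hi
        rw [Nat.zero_add]
        exact d_eq_zero.2 (initial (by simpa using hi))
    · obtain ⟨s, rfl⟩ : ∃ s, j = s + ℓ := ⟨j - ℓ, by omega⟩
      rw [← d_eq_zero, d_add (by omega), d_eq_zero]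
      exact ih s (by omega) (by omega)

theorem readVec_getD {q ℓ : ℕ} (x : List (Fin q)) (a : Fin q) {s p : ℕ} (hp : p + 1 = s + ℓ)
    (hs : s + ℓ ≤ x.length) (hl : 0 < ℓ) :
    (readVec ℓ x).getD p 0 =
      ∑ j ∈ Finset.range ℓ, Pi.single (x.getD (s + j) a) (1 : ℤ) := by
  rw [List.getD_eq_getElem _ _ (by simp [readVec]; omega), ← comp_drop_take x a s ℓ hs]
  simp [readVec, hp]

/-- if `ℓ ∣ k` and `Δ_k(R_ℓ(x))` contains the factor `0^k`
starting at position `i+k+ℓ−1` (with `1 ≤ i ≤ n−2k−ℓ+2`), then the factor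
`x[i, i+2k+ℓ−2]` is `k`-periodic. -/
theorem stmt_5 (q k ℓ : ℕ) (hq : 2 ≤ q) (hk : 2 ≤ k) (hl : 2 ≤ ℓ) (hdvd : ℓ ∣ k)
    (x : List (Fin q)) (i : ℕ) (hi : 1 ≤ i) (hin : i + 2 * k + ℓ - 2 ≤ x.length)
    (h0 : ((kderiv k (readVec ℓ x)).drop (i + k + ℓ - 2)).take k =
      List.replicate k (0 : Fin q → ℤ)) :
    (x.drop (i - 1)).take (k + ℓ - 1) = (x.drop (i - 1 + k)).take (k + ℓ - 1) := by
  obtain ⟨i, rfl⟩ : ∃ a, i = a + 1 := ⟨i - 1, by omega⟩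
  let a : Fin q := ⟨0, by omega⟩
  have key := periodic_of_window_sums_eq (by omega) hdvd (fun j => x.getD (i + j) a) (by
    intro s hs
    have hz := congrArg (fun l => l.getD s 0) h0
    have hlen : (readVec ℓ x).length = x.length + ℓ - 1 := by simp [readVec]
    have hklen : (kderiv k (readVec ℓ x)).length = x.length + ℓ - 1 := by simp [kderiv, hlen]
    rw [List.getD_eq_getElem _ _ (by simp [hklen]; omega),
      List.getD_eq_getElem _ _ (by simp; omega)] at hz
    simp only [List.getElem_take, List.getElem_drop, List.getElem_replicate, kderiv,
      List.getElem_map, List.getElem_range] at hz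
    rw [if_pos (by omega),
      readVec_getD x a (s := i + s + k) (by omega) (by omega) (by omega),
      readVec_getD x a (s := i + s) (by omega) (by omega) (by omega)] at hz
    rw [Finset.sum_sub_distrib, ← hz]
    congr 1
    · refine Finset.sum_congr rfl fun j _ => ?_
      rw [show i + (s + j + k) = i + s + k + j by omega]
    · refine Finset.sum_congr rfl fun j _ => ?_
      rw [Nat.add_assoc])
  apply List.ext_getElem
  · simp; omega
  · intro j h1 h2
    simp only [List.length_take, List.length_drop] at h1 h2
    have hj := key j (by omega)
    rw [List.getD_eq_getElem _ _ (by omega), List.getD_eq_getElem _ _ (by omega)] at hj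
    simp only [List.getElem_take, List.getElem_drop, Nat.add_sub_cancel]
    rw [← hj]
    congr 1
    omega
end

section
/- Let q ≥ 2 and k, ℓ ≥ 2 be integers with ℓ ≤ k. Let x ∈ Z_q^n and let i be an integer with 1 ≤ i ≤ n−2k−ℓ+2, and suppose Δ_k(R_ℓ(x)) contains the factor 0^k starting at position i+k+ℓ−1 (i.e., its entries at positions i+k+ℓ−1 through i+2k+ℓ−2 are all 0). Then there exists a subset I ⊆ {0,1,...,ℓ−1} such that for every s ∈ {0,1,...,ℓ−1} and every integer r with 0 ≤ r ≤ ⌊(k+ℓ−s−2)/ℓ⌋: if s ∈ I then x_{i+s+rℓ} = x_{i+k+s+rℓ}, and if s ∉ I then x_{i+s} = x_{i+s+rℓ} and x_{i+k+s} = x_{i+k+s+rℓ}. -/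
theorem comp_window {q : ℕ} (x : List (Fin q)) {d m : ℕ} (h : d ≤ m) (a : Fin q) :
    comp ((x.take m).drop d) a = ((x.take m).count a : ℤ) - (x.take d).count a := by
  have key : (x.take m).count a = (x.take d).count a + ((x.take m).drop d).count a := by
    conv_lhs => rw [← List.take_append_drop d (x.take m), List.count_append, List.take_take,
      min_eq_left h]
  simp only [comp]
  omega

theorem count_take_succ {q : ℕ} (x : List (Fin q)) {m : ℕ} (h : m < x.length) (a c : Fin q) :
    (x.take (m + 1)).count a = (x.take m).count a + if x.getD m c = a then 1 else 0 := by
  rw [List.take_add_one, List.count_append, List.getElem?_eq_getElem h, List.getD_eq_getElem _ _ h]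
  simp [List.count_singleton]

/-- A zero of the derivative says that two windows at distance `k` have equal compositions. -/
theorem comp_eq_of_kderiv_eq_zero {q k ℓ : ℕ} {x : List (Fin q)} {b : ℕ}
    (hb : b + k + ℓ ≤ x.length) (hl : 1 ≤ ℓ)
    (h : (kderiv k (readVec ℓ x))[b + k + ℓ - 1]? = some 0) (a : Fin q) :
    ((x.take (b + k + ℓ)).count a : ℤ) - (x.take (b + k)).count a =
      (x.take (b + ℓ)).count a - (x.take b).count a := by
  have entry : ∀ p < x.length + ℓ - 1,
      (readVec ℓ x).getD p 0 = comp ((x.take (p + 1)).drop (p + 1 - ℓ)) := by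
    intro p hp
    simp [readVec, List.getD, List.getElem?_range hp]
  have hlen : b + k + ℓ - 1 < (readVec ℓ x).length := by
    simp only [readVec, List.length_map, List.length_range]
    omega
  rw [kderiv, List.getElem?_map, List.getElem?_range hlen, Option.map_some, Option.some_inj,
    if_pos (by omega), entry _ (by omega), entry _ (by omega), sub_eq_zero] at h
  have h' := congrFun h a
  rwa [comp_window _ (by omega), comp_window _ (by omega),
    show b + k + ℓ - 1 + 1 = b + k + ℓ by omega, show b + k + ℓ - ℓ = b + k by omega,
    show b + k + ℓ - 1 - k + 1 = b + ℓ by omega, show b + ℓ - ℓ = b by omega] at h'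

/-- If sliding two windows of equal composition by one step keeps the compositions equal, then
either the removed letters agree and so do the added ones, or each window adds the letter it
removes. -/
theorem exchange {α : Type*} [DecidableEq α] {u u' v v' : α}
    (h : ∀ a, (if u' = a then (1 : ℤ) else 0) - (if u = a then 1 else 0) =
      (if v' = a then 1 else 0) - (if v = a then 1 else 0)) :
    (u = v → u' = v') ∧ (u ≠ v → u' = u ∧ v' = v) := by
  have h1 := h u
  have h2 := h v
  have h3 := h u'
  grind

/-- Iterating the exchange property along an arithmetic progression. -/
theorem progression {α : Type*} {ℓ N s : ℕ} {f g : ℕ → α}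
    (h : ∀ t < N, (f t = g t → f (t + ℓ) = g (t + ℓ)) ∧
      (f t ≠ g t → f (t + ℓ) = f t ∧ g (t + ℓ) = g t)) (hl : 1 ≤ ℓ)
    (r : ℕ) (hr : s + r * ℓ < N + ℓ) :
    (f s = g s → f (s + r * ℓ) = g (s + r * ℓ)) ∧
      (f s ≠ g s → f s = f (s + r * ℓ) ∧ g s = g (s + r * ℓ)) := by
  induction r with
  | zero => simp
  | succ r ih =>
    rw [Nat.succ_mul, ← add_assoc] at hr ⊢
    have hstep := h (s + r * ℓ) (by omega)
    have hih := ih (by omega)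
    grind

/-- case `ℓ ≤ k` of Lemma "0^k": if `Δ_k(R_ℓ(x))` contains `0^k`
starting at position `i+k+ℓ−1`, there is `I ⊆ {0,...,ℓ−1}` such that for all
`s ∈ {0,...,ℓ−1}` and `0 ≤ r ≤ ⌊(k+ℓ−s−2)/ℓ⌋` the stated equalities hold. -/
theorem stmt_6 (q k ℓ : ℕ) (hq : 2 ≤ q) (hk : 2 ≤ k) (hl : 2 ≤ ℓ) (hlk : ℓ ≤ k)
    (x : List (Fin q)) (i : ℕ) (hi : 1 ≤ i) (hin : i + 2 * k + ℓ - 2 ≤ x.length)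
    (h0 : ((kderiv k (readVec ℓ x)).drop (i + k + ℓ - 2)).take k =
      List.replicate k (0 : Fin q → ℤ)) :
    ∃ I : Finset (Fin ℓ), ∀ s : Fin ℓ, ∀ r : ℕ, r ≤ (k + ℓ - (s : ℕ) - 2) / ℓ →
      (s ∈ I →
        x.getD (i + (s : ℕ) + r * ℓ - 1) ⟨0, by omega⟩ =
          x.getD (i + k + (s : ℕ) + r * ℓ - 1) ⟨0, by omega⟩) ∧
      (s ∉ I →
        x.getD (i + (s : ℕ) - 1) ⟨0, by omega⟩ =
            x.getD (i + (s : ℕ) + r * ℓ - 1) ⟨0, by omega⟩ ∧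
          x.getD (i + k + (s : ℕ) - 1) ⟨0, by omega⟩ =
            x.getD (i + k + (s : ℕ) + r * ℓ - 1) ⟨0, by omega⟩) := by
  obtain ⟨b, rfl⟩ : ∃ b, i = b + 1 := ⟨i - 1, by omega⟩
  have hwin : ∀ t < k, ∀ a, ((x.take (b + t + k + ℓ)).count a : ℤ) - (x.take (b + t + k)).count a =
      (x.take (b + t + ℓ)).count a - (x.take (b + t)).count a := by
    intro t ht
    apply comp_eq_of_kderiv_eq_zero (by omega) (by omega)
    have h1 := congrArg (fun l => l[t]?) h0
    simp only [List.getElem?_take_of_lt ht, List.getElem?_drop,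
      List.getElem?_replicate_of_lt ht] at h1
    rw [← h1]
    congr 1
    omega
  set c : Fin q := ⟨0, by omega⟩
  let f : ℕ → Fin q := fun t => x.getD (b + t) c
  let g : ℕ → Fin q := fun t => x.getD (b + t + k) c
  have hstep : ∀ t < k - 1, (f t = g t → f (t + ℓ) = g (t + ℓ)) ∧
      (f t ≠ g t → f (t + ℓ) = f t ∧ g (t + ℓ) = g t) := by
    intro t ht
    apply exchange
    intro a
    have h1 := hwin t (by omega) a
    have h2 := hwin (t + 1) (by omega) a
    rw [show b + (t + 1) + k + ℓ = b + t + k + ℓ + 1 by omega,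
      show b + (t + 1) + k = b + t + k + 1 by omega,
      show b + (t + 1) + ℓ = b + t + ℓ + 1 by omega, ← add_assoc b t 1,
      count_take_succ x (by omega) a c, count_take_succ x (by omega) a c,
      count_take_succ x (by omega) a c, count_take_succ x (by omega) a c] at h2
    have hf : f (t + ℓ) = x.getD (b + t + ℓ) c := by simp only [f, add_assoc]
    have hg : g (t + ℓ) = x.getD (b + t + k + ℓ) c := by
      simp only [g, show b + (t + ℓ) + k = b + t + k + ℓ by omega]
    simp only [hf, hg]
    push_cast at h2
    simp only [f, g]
    linarith
  refine ⟨Finset.univ.filter fun s : Fin ℓ => f s = g s, fun s r hr => ?_⟩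
  have hr' : (s : ℕ) + r * ℓ < k - 1 + ℓ := by
    have := (Nat.le_div_iff_mul_le (by omega)).1 hr
    have := s.2
    omega
  have hprog := progression hstep (by omega) r hr'
  simp only [Finset.mem_filter, Finset.mem_univ, true_and]
  rw [show b + 1 + (s : ℕ) + r * ℓ - 1 = b + (s + r * ℓ) by omega,
    show b + 1 + k + (s : ℕ) + r * ℓ - 1 = b + (s + r * ℓ) + k by omega,
    show b + 1 + (s : ℕ) - 1 = b + s by omega,
    show b + 1 + k + (s : ℕ) - 1 = b + s + k by omega]
  exact hprog
end

section
/- Let q ≥ 2 and k, ℓ ≥ 2 be integers with ℓ > k. Let x ∈ Z_q^n and let i be an integer with 1 ≤ i ≤ n−2k−ℓ+2, and suppose Δ_k(R_ℓ(x)) contains the factor 0^k starting at position i+k+ℓ−1 (i.e., its entries at positions i+k+ℓ−1 through i+2k+ℓ−2 are all 0). Then there exists a subset I ⊆ {0,1,...,k−2} such that for every s ∈ {0,1,...,k−2}: if s ∈ I then x_{i+s} = x_{i+ℓ+s} and x_{i+k+s} = x_{i+k+ℓ+s}, and if s ∉ I then x_{i+s} = x_{i+k+s} and x_{i+ℓ+s}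 = x_{i+k+ℓ+s}. -/
theorem comp_drop_take_s7 {q : ℕ} (x : List (Fin q)) {b c : ℕ} (h : c ≤ b) :
    comp ((x.take b).drop c) = comp (x.take b) - comp (x.take c) := by
  have hx : x.take b = x.take c ++ (x.take b).drop c := by
    conv_lhs => rw [← List.take_append_drop c (x.take b), List.take_take, min_eq_left h]
  funext a
  have := congrArg (List.count a) hx
  rw [List.count_append] at this
  simp only [comp, Pi.sub_apply]
  omega

theorem comp_take_succ {q : ℕ} (x : List (Fin q)) {m : ℕ} (h : m < x.length) (d : Fin q) :
    comp (x.take (m + 1)) = comp (x.take m) + Pi.single (x.getD m d) 1 := by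
  funext a
  rw [← List.take_append_getElem h, List.getD_eq_getElem _ _ h]
  simp only [comp, List.count_append, List.count_singleton, Pi.add_apply, Pi.single_apply,
    beq_iff_eq, Nat.cast_add, Nat.cast_ite, Nat.cast_one, Nat.cast_zero, eq_comm (b := a)]

theorem readVec_getD_s7 {q : ℕ} (ℓ : ℕ) (x : List (Fin q)) {p : ℕ} (h : p < x.length + ℓ - 1) :
    (readVec ℓ x).getD p 0 = comp (x.take (p + 1)) - comp (x.take (p + 1 - ℓ)) := by
  rw [← comp_drop_take_s7 x (Nat.sub_le _ _)]
  simp [readVec, List.getD_eq_getElem?_getD, h]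

theorem kderiv_getD {G : Type*} [AddCommGroup G] (k : ℕ) (y : List G) {p : ℕ}
    (hk : k ≤ p) (h : p < y.length) :
    (kderiv k y).getD p 0 = y.getD p 0 - y.getD (p - k) 0 := by
  simp [kderiv, List.getD_eq_getElem?_getD, h, hk]

theorem getD_eq_zero_of_take_drop {G : Type*} [Zero G] {y : List G} {m k j : ℕ}
    (h : (y.drop m).take k = List.replicate k 0) (hj : j < k) : y.getD (m + j) 0 = 0 := by
  have := congrArg (fun l => l.getD j 0) h
  simpa [List.getD_eq_getElem?_getD, List.getElem?_take, hj] using this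

/-- Two pairs of letters with the same composition agree up to order. -/
theorem eq_or_eq_of_single_add_single {α : Type*} [DecidableEq α] {a b c d : α}
    (h : (Pi.single a 1 + Pi.single d 1 : α → ℤ) = Pi.single b 1 + Pi.single c 1) :
    (a = c ∧ b = d) ∨ (a = b ∧ c = d) := by
  have ha := congrFun h a
  have hb := congrFun h b
  have hc := congrFun h c
  have hd := congrFun h d
  simp only [Pi.add_apply, Pi.single_apply] at ha hb hc hd
  grind

/-- case `ℓ > k` of Lemma "0^k": if `Δ_k(R_ℓ(x))` contains `0^k`
starting at position `i+k+ℓ−1`, there is `I ⊆ {0,...,k−2}` such that for all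
`s ∈ {0,...,k−2}` the stated equalities hold. -/
theorem stmt_7 (q k ℓ : ℕ) (hq : 2 ≤ q) (hk : 2 ≤ k) (hl : 2 ≤ ℓ) (hkl : k < ℓ)
    (x : List (Fin q)) (i : ℕ) (hi : 1 ≤ i) (hin : i + 2 * k + ℓ - 2 ≤ x.length)
    (h0 : ((kderiv k (readVec ℓ x)).drop (i + k + ℓ - 2)).take k =
      List.replicate k (0 : Fin q → ℤ)) :
    ∃ I : Finset (Fin (k - 1)), ∀ s : Fin (k - 1),
      (s ∈ I →
        x.getD (i + (s : ℕ) - 1) ⟨0, by omega⟩ =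
            x.getD (i + ℓ + (s : ℕ) - 1) ⟨0, by omega⟩ ∧
          x.getD (i + k + (s : ℕ) - 1) ⟨0, by omega⟩ =
            x.getD (i + k + ℓ + (s : ℕ) - 1) ⟨0, by omega⟩) ∧
      (s ∉ I →
        x.getD (i + (s : ℕ) - 1) ⟨0, by omega⟩ =
            x.getD (i + k + (s : ℕ) - 1) ⟨0, by omega⟩ ∧
          x.getD (i + ℓ + (s : ℕ) - 1) ⟨0, by omega⟩ =
            x.getD (i + k + ℓ + (s : ℕ) - 1) ⟨0, by omega⟩) := by
  set d : Fin q := ⟨0, by omega⟩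
  have hz : ∀ s < k, comp (x.take (i + k + ℓ + s - 1)) - comp (x.take (i + k + s - 1)) -
      (comp (x.take (i + ℓ + s - 1)) - comp (x.take (i + s - 1))) = 0 := by
    intro s hs
    have h := getD_eq_zero_of_take_drop h0 hs
    rw [kderiv_getD k _ (by omega) (by simp only [readVec, List.length_map, List.length_range]; omega),
      readVec_getD_s7 ℓ x (by omega), readVec_getD_s7 ℓ x (by omega)] at h
    rwa [show i + k + ℓ - 2 + s + 1 = i + k + ℓ + s - 1 by omega,
      show i + k + ℓ + s - 1 - ℓ = i + k + s - 1 by omega,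
      show i + k + ℓ - 2 + s - k + 1 = i + ℓ + s - 1 by omega,
      show i + ℓ + s - 1 - ℓ = i + s - 1 by omega] at h
  have key : ∀ s < k - 1,
      (x.getD (i + s - 1) d = x.getD (i + ℓ + s - 1) d ∧
        x.getD (i + k + s - 1) d = x.getD (i + k + ℓ + s - 1) d) ∨
      (x.getD (i + s - 1) d = x.getD (i + k + s - 1) d ∧
        x.getD (i + ℓ + s - 1) d = x.getD (i + k + ℓ + s - 1) d) := by
    intro s hs
    apply eq_or_eq_of_single_add_single
    have step : ∀ m, 1 ≤ m → m + s - 1 < x.length →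
        comp (x.take (m + (s + 1) - 1)) =
          comp (x.take (m + s - 1)) + Pi.single (x.getD (m + s - 1) d) 1 := by
      intro m hm hlt
      rw [← comp_take_succ x hlt d]
      congr 2
      omega
    have h1 := hz s (by omega)
    have h2 := hz (s + 1) (by omega)
    rw [step _ (by omega) (by omega), step _ (by omega) (by omega),
      step _ (by omega) (by omega), step _ (by omega) (by omega)] at h2
    linear_combination h2 - h1
  classical
  refine ⟨Finset.univ.filter fun s : Fin (k - 1) =>
    x.getD (i + (s : ℕ) - 1) d = x.getD (i + ℓ + (s : ℕ) - 1) d ∧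
      x.getD (i + k + (s : ℕ) - 1) d = x.getD (i + k + ℓ + (s : ℕ) - 1) d, fun s => ?_⟩
  rw [Finset.mem_filter_univ]
  exact ⟨id, (key s s.isLt).resolve_left⟩
end

section
/- Let q ≥ 2 and k, ℓ ≥ 2 be integers. For every n ≥ 2k+ℓ−1, |F_{k,ℓ}(n)| ≤ |F_{k,ℓ}(n+1)|. -/
/-- Appending a letter that differs from the one `k` positions earlier preserves fineness. -/
theorem Fine.append_singleton {q k ℓ : ℕ} (hk : 1 ≤ k) (hl : 1 ≤ ℓ) {x : List (Fin q)}
    (hx : Fine k ℓ x) {a : Fin q} (ha : x[x.length - k]? ≠ some a) : Fine k ℓ (x ++ [a]) := by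
  intro i hi hlen heq
  have key : ∀ j < k + ℓ - 1, (x ++ [a])[i - 1 + j]? = (x ++ [a])[i - 1 + k + j]? := by
    intro j hj
    have h := congrArg (fun w : List (Fin q) => w[j]?) heq
    simpa [List.getElem?_take, hj] using h
  rw [List.length_append, List.length_singleton] at hlen
  rcases Nat.lt_or_ge x.length (i + 2 * k + ℓ - 2) with h | h
  · have hj := key (k + ℓ - 2) (by omega)
    rw [show i - 1 + k + (k + ℓ - 2) = x.length by omega,
      show i - 1 + (k + ℓ - 2) = x.length - k by omega,
      List.getElem?_append_left (by omega), List.getElem?_concat_length] at hj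
    exact ha hj
  · refine hx i hi h (List.ext_getElem? fun j => ?_)
    by_cases hj : j < k + ℓ - 1
    · have h' := key j hj
      rw [List.getElem?_append_left (by omega), List.getElem?_append_left (by omega)] at h'
      simpa [List.getElem?_take, hj] using h'
    · simp [hj]

/-- for every `n ≥ 2k+ℓ−1`, `|F_{k,ℓ}(n)| ≤ |F_{k,ℓ}(n+1)|`. -/
theorem stmt_8 (q k ℓ : ℕ) (hq : 2 ≤ q) (hk : 2 ≤ k) (hl : 2 ≤ ℓ) (n : ℕ)
    (hn : 2 * k + ℓ - 1 ≤ n) :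
    Nat.card {x : Fin n → Fin q // Fine k ℓ (List.ofFn x)} ≤
      Nat.card {x : Fin (n + 1) → Fin q // Fine k ℓ (List.ofFn x)} := by
  have : Nontrivial (Fin q) := Fin.nontrivial_iff_two_le.mpr hq
  have extend (x : {x : Fin n → Fin q // Fine k ℓ (List.ofFn x)}) :
      ∃ a : Fin q, Fine k ℓ (List.ofFn (Fin.snoc x.1 a : Fin (n + 1) → Fin q)) := by
    obtain ⟨a, ha⟩ := exists_ne (x.1 ⟨n - k, by omega⟩)
    refine ⟨a, ?_⟩
    have h : List.ofFn (Fin.snoc x.1 a : Fin (n + 1) → Fin q) = List.ofFn x.1 ++ [a] := by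
      rw [List.ofFn_succ']
      simp
    rw [h]
    refine x.2.append_singleton (by omega) (by omega) ?_
    rw [List.length_ofFn, List.getElem?_eq_getElem (by rw [List.length_ofFn]; omega),
      List.getElem_ofFn]
    simpa using ha.symm
  choose f hf using extend
  refine Nat.card_le_card_of_injective
    (fun x => (⟨Fin.snoc x.1 (f x), hf x⟩ :
      {x : Fin (n + 1) → Fin q // Fine k ℓ (List.ofFn x)})) fun x y hxy => ?_
  have h := congrArg (fun z => Fin.init z.1) hxy
  simpa [Fin.init_snoc, Subtype.ext_iff] using h
end

section
/- Let q ≥ 2 and k, ℓ ≥ 2 be integers with ℓ | k. For every n ≥ 2k+ℓ−1: {x ∈ Z_q^n : Δ_k(R_ℓ(x)) does not contain the factor 0^k} = F_{k,ℓ}(n). -/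
open Finset in
/-- If `d` has vanishing window sums of length `ℓ` at `k` consecutive positions, then it is
`ℓ`-periodic on the range covered by these windows. -/
theorem periodic_of_window_sum_eq_zero {G : Type*} [AddCommGroup G] {k ℓ : ℕ} {d : ℕ → G}
    (h : ∀ t < k, ∑ i ∈ range ℓ, d (t + i) = 0) {t : ℕ} (ht : t + 1 < k) :
    d (t + ℓ) = d t := by
  have h1 := h (t + 1) ht
  have h0 : ∑ i ∈ range (ℓ + 1), d (t + i) = d (t + ℓ) := by
    rw [sum_range_succ, h t (by omega), zero_add]
  rw [sum_range_succ'] at h0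
  have h2 : ∑ i ∈ range ℓ, d (t + (i + 1)) = ∑ i ∈ range ℓ, d (t + 1 + i) :=
    sum_congr rfl fun i _ => by congr 1; omega
  rw [h2, h1] at h0
  simpa using h0.symm

open Finset in
/-- A `0/1`-valued sequence whose window sums of length `ℓ ∣ k` agree with their `k`-shifts at `k`
consecutive positions is `k`-periodic on the range covered by these windows. -/
theorem shift_eq_of_window_sum_eq {k ℓ : ℕ} (hl : 0 < ℓ) (hdvd : ℓ ∣ k) {X : ℕ → ℤ}
    (hX : ∀ i, X i = 0 ∨ X i = 1)
    (h : ∀ t < k, ∑ i ∈ range ℓ, X (t + k + i) = ∑ i ∈ range ℓ, X (t + i))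
    {i : ℕ} (hi : i < k + ℓ - 1) : X (i + k) = X i := by
  have hD : ∀ t < k, ∑ i ∈ range ℓ, (fun j => X (j + k) - X j) (t + i) = 0 := by
    intro t ht
    rw [sum_sub_distrib, sub_eq_zero, ← h t ht]
    exact sum_congr rfl fun i _ => by congr 1; omega
  obtain ⟨m, rfl⟩ := hdvd
  set k := ℓ * m with hkm
  set d : ℕ → ℤ := fun j => X (j + k) - X j with hd
  have hper : ∀ t, t + 1 < k → d (t + ℓ) = d t :=
    fun t ht => periodic_of_window_sum_eq_zero hD ht
  have hmul : ∀ r ≤ m, ∀ t, t + 1 < ℓ → d (t + ℓ * r) = d t := by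
    intro r
    induction r with
    | zero => simp
    | succ r ih =>
      intro hr t ht
      have h1 : ℓ * (r + 1) ≤ k := Nat.mul_le_mul_left ℓ hr
      rw [mul_add, mul_one] at h1 ⊢
      rw [← add_assoc, hper _ (by omega), ih (by omega) t ht]
  have hsmall : ∀ t, t + 1 < ℓ → d t = 0 := by
    intro t ht
    have h1 := hmul m le_rfl t ht
    rw [← hkm] at h1
    simp only [hd] at h1 ⊢
    have := hX t
    have := hX (t + k)
    have := hX (t + k + k)
    omega
  have hall : ∀ t < k + ℓ - 1, d t = 0 := by
    intro t
    induction t using Nat.strong_induction_on with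
    | _ t ih =>
      intro ht
      rcases lt_trichotomy (t + 1) ℓ with h1 | h1 | h1
      · exact hsmall t h1
      · have h2 := hD 0 (by omega)
        rw [← h1, sum_range_succ, sum_eq_zero fun i hi => ?_] at h2
        · simpa using h2
        · simpa using hsmall i (by have := mem_range.1 hi; omega)
      · have h2 := hper (t - ℓ) (by omega)
        rw [Nat.sub_add_cancel (by omega)] at h2
        rw [h2]
        exact ih _ (by omega) (by omega)
  exact sub_eq_zero.1 (hall i hi)

theorem List.count_take_drop_eq_sum {α : Type*} [DecidableEq α] (x : List α) (a : α) (u ℓ : ℕ) :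
    (((x.drop u).take ℓ).count a : ℤ) =
      ∑ i ∈ Finset.range ℓ, if x[u + i]? = some a then (1 : ℤ) else 0 := by
  induction ℓ with
  | zero => simp
  | succ ℓ ih =>
    rw [Finset.sum_range_succ, ← ih, List.take_add_one, List.count_append, List.getElem?_drop]
    cases h : x[u + ℓ]? with
    | none => simp
    | some b => simp [List.count_singleton]

theorem List.take_drop_eq_iff {α : Type*} (x : List α) (u v m : ℕ) :
    (x.drop u).take m = (x.drop v).take m ↔ ∀ i < m, x[u + i]? = x[v + i]? := by
  constructor
  · intro h i hi
    have := congrArg (fun l => l[i]?) h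
    simpa [List.getElem?_take, hi] using this
  · intro h
    ext1 i
    by_cases hi : i < m
    · simpa [List.getElem?_take, hi] using h i hi
    · simp [hi]

theorem length_eq_of_comp_eq {q : ℕ} {u v : List (Fin q)} (h : comp u = comp v) :
    u.length = v.length :=
  (List.perm_iff_count.2 fun a => by simpa [comp] using congrFun h a).length_eq

theorem length_kderiv_readVec {q : ℕ} (k ℓ : ℕ) (x : List (Fin q)) :
    (kderiv k (readVec ℓ x)).length = x.length + ℓ - 1 := by
  simp [kderiv, readVec]

theorem kderiv_readVec_getElem? {q k ℓ p : ℕ} {x : List (Fin q)} (hp : p < x.length + ℓ - 1) :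
    (kderiv k (readVec ℓ x))[p]? = some (comp ((x.take (p + 1)).drop (p + 1 - ℓ)) -
      if k ≤ p then comp ((x.take (p - k + 1)).drop (p - k + 1 - ℓ)) else 0) := by
  have hp' : p - k < x.length + ℓ - 1 := by omega
  simp [kderiv, readVec, hp, hp', List.getD_eq_getElem?_getD]

theorem hasZeroBlock_iff {G : Type*} [Zero G] (k : ℕ) (y : List G) :
    HasZeroBlock k y ↔ ∃ j, j + k ≤ y.length ∧ ∀ t < k, y[j + t]? = some 0 := by
  refine exists_congr fun j => and_congr_right fun _ => ?_
  constructor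
  · intro h t ht
    have := congrArg (fun l => l[t]?) h
    simpa [List.getElem?_take, List.getElem?_replicate, ht] using this
  · intro h
    ext1 t
    by_cases ht : t < k
    · simpa [List.getElem?_take, List.getElem?_replicate, ht] using h t ht
    · simp [ht]

/-- Zeros of the derivative of the read vector only occur where both windows are full. -/
theorem kderiv_readVec_getElem?_eq_zero {q k ℓ p : ℕ} {x : List (Fin q)} (hl : 0 < ℓ)
    (hlk : ℓ ≤ k) (hn : 2 * k + ℓ - 1 ≤ x.length) (hp : p < x.length + ℓ - 1) :
    (kderiv k (readVec ℓ x))[p]? = some 0 ↔ k + ℓ - 1 ≤ p ∧ p < x.length ∧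
      comp ((x.drop (p + 1 - ℓ)).take ℓ) = comp ((x.drop (p + 1 - ℓ - k)).take ℓ) := by
  rw [kderiv_readVec_getElem? hp, Option.some_inj, sub_eq_zero]
  by_cases hin : k + ℓ - 1 ≤ p ∧ p < x.length
  · have e1 : p - k + 1 - ℓ = p + 1 - ℓ - k := by omega
    have e2 : p - k + 1 - (p + 1 - ℓ - k) = ℓ := by omega
    have e3 : p + 1 - (p + 1 - ℓ) = ℓ := by omega
    rw [if_pos (by omega), List.drop_take, List.drop_take, e1, e2, e3]
    simp [hin]
  · refine iff_of_false (fun h => hin ?_) (fun h => hin ⟨h.1, h.2.1⟩)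
    split_ifs at h with hkp
    · have := length_eq_of_comp_eq h
      simp only [List.length_drop, List.length_take] at this
      omega
    · have h' : comp ((x.take (p + 1)).drop (p + 1 - ℓ)) = comp ([] : List (Fin q)) := by
        rw [h]; ext a; simp [comp]
      have := length_eq_of_comp_eq h'
      simp only [List.length_drop, List.length_take, List.length_nil] at this
      omega

theorem hasZeroBlock_kderiv_readVec_iff {q k ℓ : ℕ} {x : List (Fin q)} (hk : 0 < k) (hl : 0 < ℓ)
    (hdvd : ℓ ∣ k) (hn : 2 * k + ℓ - 1 ≤ x.length) :
    HasZeroBlock k (kderiv k (readVec ℓ x)) ↔ ¬ Fine k ℓ x := by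
  have hlk := Nat.le_of_dvd hk hdvd
  rw [hasZeroBlock_iff, length_kderiv_readVec]
  simp only [Fine, not_forall, not_not]
  constructor
  · rintro ⟨j, hj, h⟩
    have hz t (ht : t < k) :=
      (kderiv_readVec_getElem?_eq_zero hl hlk hn (p := j + t) (by omega)).1 (h t ht)
    have hfirst := (hz 0 hk).1
    have hlast := (hz (k - 1) (by omega)).2.1
    obtain ⟨s, rfl⟩ : ∃ s, j = s + (k + ℓ - 1) := ⟨j - (k + ℓ - 1), by omega⟩
    refine ⟨s + 1, by omega, by omega, ?_⟩
    rw [List.take_drop_eq_iff]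
    intro i hi
    have key (a : Fin q) := shift_eq_of_window_sum_eq (k := k) hl hdvd
      (X := fun i => if x[s + i]? = some a then (1 : ℤ) else 0)
      (fun i => by split_ifs <;> simp) (fun t ht => by
        have h1 := congrFun (hz t ht).2.2 a
        simp only [comp, List.count_take_drop_eq_sum] at h1
        have e1 : s + (k + ℓ - 1) + t + 1 - ℓ = s + (t + k) := by omega
        have e2 : s + (t + k) - k = s + t := by omega
        rw [e1, e2] at h1
        simpa only [add_assoc] using h1) hi
    have e1 : s + 1 - 1 + i = s + i := by omega
    have e2 : s + 1 - 1 + k + i = s + (i + k) := by omega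
    rw [e1, e2]
    have hb : s + i < x.length := by omega
    have := key x[s + i]
    rw [List.getElem?_eq_getElem hb] at this ⊢
    by_contra hne
    rw [if_neg (Ne.symm hne), if_pos rfl] at this
    exact zero_ne_one this
  · rintro ⟨i, hi, hin, h⟩
    rw [List.take_drop_eq_iff] at h
    refine ⟨i - 1 + (k + ℓ - 1), by omega, fun t ht => ?_⟩
    rw [kderiv_readVec_getElem?_eq_zero hl hlk hn (by omega)]
    refine ⟨by omega, by omega, congrArg comp ?_⟩
    rw [List.take_drop_eq_iff]
    intro r hr
    have := h (t + r) (by omega)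
    convert this.symm using 2 <;> omega

/-- if `ℓ ∣ k`, then for every `n ≥ 2k+ℓ−1`,
`{x ∈ Z_q^n : Δ_k(R_ℓ(x)) contains no factor 0^k} = F_{k,ℓ}(n)`. -/
theorem stmt_11 (q k ℓ : ℕ) (hq : 2 ≤ q) (hk : 2 ≤ k) (hl : 2 ≤ ℓ) (hdvd : ℓ ∣ k)
    (n : ℕ) (hn : 2 * k + ℓ - 1 ≤ n) :
    {x : Fin n → Fin q | ¬HasZeroBlock k (kderiv k (readVec ℓ (List.ofFn x)))} =
      {x : Fin n → Fin q | Fine k ℓ (List.ofFn x)} := by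
  ext x
  rw [Set.mem_ofPred_eq, Set.mem_ofPred_eq,
    hasZeroBlock_kderiv_readVec_iff (by omega) (by omega) hdvd (by simpa using hn), not_not]
end
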